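/- Let E be a finite-dimensional real inner product space and let A : ℝ → End(E) be a continuous map with sup_{t∈ℝ} ‖A(t)‖ < ∞, such that A(t) converges as t → −∞ and as t → +∞ to operators A₋ and A₊ respectively, each of which is self-adjoint and invertible. Let h₁, …, hₘ : ℝ → E be continuously differentiable solutions of h'(t) + A(t)h(t) = 0 which decay exponentially (there exist C, δ > 0 with ‖hᵢ(t)‖ ≤ C·e^(−δ|t|) for all t and all i), which are L²-orthonormal (∫_ℝ ⟨hᵢ(t), hⱼ(t)⟩ dt = 1 if i = j and 0 otherwise), and which are such that every bounded continuously differentiable solution of h'(t) + A(t)h(t) = 0 is a linear combination of h₁, …, hₘ. Then there exists a constant B > 0 such that for every continuously differentiable function f : ℝ → E with f and f' bounded, sup_{t∈ℝ} ‖f(t)‖ + sup_{t∈ℝ} ‖f'(t)‖ ≤ B·( sup_{t∈ℝ} ‖f'(t) + A(t)f(t)‖ + Σᵢ |∫_ℝ ⟨f(t), hᵢ(t)⟩ dt| ). -/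

import Mathlib

open scoped RealInnerProductSpace

/-- A differential inequality `u' ≤ a u + d` makes `exp (-a t) (u + d / a)` nonincreasing. -/
lemma antitoneOn_exp_mul_add_div {u u' : ℝ → ℝ} {a d T : ℝ} (ha : a ≠ 0)
    (hu : ∀ t, HasDerivAt u (u' t) t) (h : ∀ t, T ≤ t → u' t ≤ a * u t + d) :
    AntitoneOn (fun t => Real.exp (-(a * t)) * (u t + d / a)) (Set.Ici T) := by
  have hd : ∀ t, HasDerivAt (fun t => Real.exp (-(a * t)) * (u t + d / a))
      (Real.exp (-(a * t)) * (u' t - (a * u t + d))) t := by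
    intro t
    have h1 : HasDerivAt (fun t : ℝ => -(a * t)) (-(a * 1)) t :=
      ((hasDerivAt_id t).const_mul a).neg
    have h2 := h1.exp.mul ((hu t).add_const (d / a))
    refine h2.congr_deriv ?_
    field_simp
    ring
  refine antitoneOn_of_hasDerivWithinAt_nonpos (convex_Ici T)
    (fun t _ => (hd t).continuousAt.continuousWithinAt)
    (fun t _ => (hd t).hasDerivWithinAt) fun t ht => ?_
  rw [interior_Ici] at ht
  exact mul_nonpos_of_nonneg_of_nonpos (Real.exp_pos _).le (by linarith [h t ht.le])

lemma le_abs_add_div_of_deriv_le_neg_mul_add {u u' : ℝ → ℝ} {c d T : ℝ} (hc : 0 < c)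
    (hd : 0 ≤ d) (hu : ∀ t, HasDerivAt u (u' t) t)
    (h : ∀ t, T ≤ t → u' t ≤ -c * u t + d) {t : ℝ} (ht : T ≤ t) :
    u t ≤ |u T| + d / c := by
  have h1 := antitoneOn_exp_mul_add_div (neg_ne_zero.2 hc.ne') hu h
    (Set.self_mem_Ici (a := T)) ht ht
  simp only [neg_mul, neg_neg, div_neg] at h1
  have hdc : 0 ≤ d / c := by positivity
  have h2 : Real.exp (c * T) * (u T + -(d / c)) ≤ Real.exp (c * T) * |u T| := by
    gcongr
    linarith [le_abs_self (u T)]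
  have h3 : Real.exp (c * T) * |u T| ≤ Real.exp (c * t) * |u T| := by gcongr
  have h4 := le_of_mul_le_mul_left ((h1.trans h2).trans h3) (Real.exp_pos _)
  linarith

lemma neg_div_le_of_deriv_le_mul_add {u u' : ℝ → ℝ} {c d T M : ℝ} (hc : 0 < c)
    (hu : ∀ t, HasDerivAt u (u' t) t) (h : ∀ t, T ≤ t → u' t ≤ c * u t + d)
    (hM : ∀ t, M ≤ u t) {t : ℝ} (ht : T ≤ t) : -(d / c) ≤ u t := by
  by_contra! hlt
  have h1 : ∀ s, t ≤ s → Real.exp (-(c * s)) * (M + d / c) ≤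
      Real.exp (-(c * t)) * (u t + d / c) := by
    intro s hs
    refine le_trans ?_ (antitoneOn_exp_mul_add_div hc.ne' hu h (Set.mem_Ici.2 ht)
      (Set.mem_Ici.2 (ht.trans hs)) hs)
    exact mul_le_mul_of_nonneg_left (by linarith [hM s]) (Real.exp_pos _).le
  have h2 : Filter.Tendsto (fun s => Real.exp (-(c * s)) * (M + d / c)) Filter.atTop
      (nhds (0 * (M + d / c))) :=
    (Real.tendsto_exp_neg_atTop_nhds_zero.comp
      (Filter.tendsto_id.const_mul_atTop hc)).mul_const _
  rw [zero_mul] at h2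
  have h3 := le_of_tendsto h2 ((Filter.eventually_ge_atTop t).mono h1)
  have h4 := mul_neg_of_pos_of_neg (Real.exp_pos (-(c * t))) (by linarith : u t + d / c < 0)
  linarith

/-- If `A` is uniformly close to a self-adjoint operator bounded below by `μ` on `[T, ∞)`, then
bounded functions `f` are controlled there by `f T` and a bound for `f' + A f`. -/
lemma exists_norm_le_of_near_selfAdjoint {E : Type*} [NormedAddCommGroup E]
    [InnerProductSpace ℝ E] (A : ℝ → E →L[ℝ] E) (S : E →L[ℝ] E) {T L μ : ℝ} (hμ : 0 < μ)
    (hS : ∀ x y : E, ⟪S x, y⟫ = ⟪x, S y⟫) (hSμ : ∀ x, μ * ‖x‖ ≤ ‖S x‖)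
    (hSL : ‖S‖ ≤ L) (hAL : ∀ t, ‖A t‖ ≤ L) (hAS : ∀ t, T ≤ t → ‖A t - S‖ ≤ μ / 4) :
    ∃ C : ℝ, 0 < C ∧ ∀ (f f' : ℝ → E) (N : ℝ), (∀ t, HasDerivAt f (f' t) t) →
      (∃ K, ∀ t, ‖f t‖ ≤ K) → (∀ t, ‖f' t + A t (f t)‖ ≤ N) →
      ∀ t, T ≤ t → ‖f t‖ ≤ C * (‖f T‖ + N) := by
  have hL : 0 ≤ L := (norm_nonneg _).trans hSL
  obtain ⟨s, hs, hsL⟩ : ∃ s : ℝ, 0 < s ∧ s * (2 * L + 1) = μ ^ 2 / 4 :=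
    ⟨μ ^ 2 / 4 / (2 * L + 1), by positivity, by field_simp⟩
  obtain ⟨c, hc, hcL⟩ : ∃ c : ℝ, 0 < c ∧ c * (L + s) = μ ^ 2 / 2 :=
    ⟨μ ^ 2 / 2 / (L + s), by positivity, by field_simp⟩
  set R : ℝ := (L + s) / (2 * s) + 2 * ((2 + s) / c) / (2 * s) with hR
  have hRpos : 0 < R := by positivity
  refine ⟨R + 1, by positivity, ?_⟩
  intro f f' N hf ⟨K, hK⟩ hN t ht
  have hN0 : 0 ≤ N := (norm_nonneg _).trans (hN 0)
  have hq : ∀ t, HasDerivAt (fun t => ⟪f t, f t⟫) (⟪f t, f' t⟫ + ⟪f' t, f t⟫) t :=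
    fun t => (hf t).inner ℝ (hf t)
  have hV : ∀ t, HasDerivAt (fun t => ⟪f t, S (f t)⟫) (⟪f t, S (f' t)⟫ + ⟪f' t, S (f t)⟫) t :=
    fun t => (hf t).inner ℝ (S.hasFDerivAt.comp_hasDerivAt t (hf t))
  have hVle : ∀ t, |⟪f t, S (f t)⟫| ≤ L * ‖f t‖ ^ 2 := by
    intro t
    calc |⟪f t, S (f t)⟫| ≤ ‖f t‖ * ‖S (f t)‖ := abs_real_inner_le_norm _ _
      _ ≤ ‖f t‖ * (L * ‖f t‖) := by gcongr; exact S.le_of_opNorm_le hSL _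
      _ = _ := by ring
  have hqd : ∀ t, |⟪f t, f' t⟫ + ⟪f' t, f t⟫| ≤ (2 * L + 1) * ‖f t‖ ^ 2 + N ^ 2 := by
    intro t
    have h1 : ‖f' t‖ ≤ N + L * ‖f t‖ := by
      calc ‖f' t‖ = ‖(f' t + A t (f t)) - A t (f t)‖ := by rw [add_sub_cancel_right]
        _ ≤ ‖f' t + A t (f t)‖ + ‖A t (f t)‖ := norm_sub_le _ _
        _ ≤ _ := add_le_add (hN t) ((A t).le_of_opNorm_le (hAL t) _)
    have h2 := abs_real_inner_le_norm (f t) (f' t)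
    rw [real_inner_comm (f t) (f' t), ← two_mul, abs_mul, abs_two]
    nlinarith [mul_le_mul_of_nonneg_left h1 (norm_nonneg (f t)), sq_nonneg (‖f t‖ - N)]
  have hVd : ∀ t, T ≤ t → ⟪f t, S (f' t)⟫ + ⟪f' t, S (f t)⟫ ≤
      -(3 / 4 * μ ^ 2) * ‖f t‖ ^ 2 + 2 * N ^ 2 := by
    intro t ht
    obtain ⟨r, hr⟩ : ∃ r, r = f' t + S (f t) := ⟨_, rfl⟩
    have hrN : ‖r‖ ≤ N + μ / 4 * ‖f t‖ := by
      calc ‖r‖ = ‖(f' t + A t (f t)) - (A t - S) (f t)‖ := by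
            rw [hr, sub_apply]; congr 1; abel
        _ ≤ ‖f' t + A t (f t)‖ + ‖(A t - S) (f t)‖ := norm_sub_le _ _
        _ ≤ _ := add_le_add (hN t) ((A t - S).le_of_opNorm_le (hAS t ht) _)
    have hf't : f' t = r - S (f t) := by rw [hr]; abel
    have h1 : ⟪f t, S (f' t)⟫ = ⟪f' t, S (f t)⟫ := by
      rw [← hS, real_inner_comm]
    have h2 : ⟪f' t, S (f t)⟫ = ⟪r, S (f t)⟫ - ‖S (f t)‖ ^ 2 := by
      rw [hf't, inner_sub_left, real_inner_self_eq_norm_sq]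
    have h3 := real_inner_le_norm r (S (f t))
    have h4 : (μ * ‖f t‖) ^ 2 ≤ ‖S (f t)‖ ^ 2 := by gcongr; exact hSμ _
    have h5 : ‖r‖ ^ 2 ≤ (N + μ / 4 * ‖f t‖) ^ 2 := by gcongr
    nlinarith [sq_nonneg (‖r‖ - ‖S (f t)‖), sq_nonneg (N - μ / 4 * ‖f t‖)]
  have hqq : ∀ t, ⟪f t, f t⟫ = ‖f t‖ ^ 2 := fun t => real_inner_self_eq_norm_sq _
  have hd : 0 ≤ (2 + s) * N ^ 2 := by positivity
  have key1 := le_abs_add_div_of_deriv_le_neg_mul_add (T := T) hc hd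
    (fun t => (hV t).add ((hq t).const_mul s)) (by
      intro t ht
      have a1 := hVd t ht
      have a2 := mul_le_mul_of_nonneg_left (abs_le.1 (hqd t)).2 hs.le
      have a3 := mul_le_mul_of_nonneg_left (abs_le.1 (hVle t)).2 hc.le
      simp only [Pi.add_apply, hqq]
      linear_combination a1 + a2 + a3 + ‖f t‖ ^ 2 * hsL + ‖f t‖ ^ 2 * hcL) ht
  have key2 := neg_div_le_of_deriv_le_mul_add (T := T) (d := (2 + s) * N ^ 2)
    (M := -((L + s) * K ^ 2)) hc
    (fun t => (hV t).sub ((hq t).const_mul s)) (by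
      intro t ht
      have a1 := hVd t ht
      have a2 := mul_le_mul_of_nonneg_left (abs_le.1 (hqd t)).1 hs.le
      have a3 := mul_le_mul_of_nonneg_left (abs_le.1 (hVle t)).1 hc.le
      simp only [Pi.sub_apply, hqq]
      linear_combination a1 + a2 + a3 + ‖f t‖ ^ 2 * hsL + ‖f t‖ ^ 2 * hcL) (by
      intro t
      have a1 := (abs_le.1 (hVle t)).1
      have a2 : ‖f t‖ ^ 2 ≤ K ^ 2 := by gcongr; exact hK t
      simp only [Pi.sub_apply, hqq]
      nlinarith) ht
  simp only [Pi.add_apply, Pi.sub_apply, hqq] at key1 key2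
  have hT : |⟪f T, S (f T)⟫ + s * ‖f T‖ ^ 2| ≤ (L + s) * ‖f T‖ ^ 2 := by
    refine (abs_add_le _ _).trans ?_
    rw [abs_of_nonneg (by positivity : 0 ≤ s * ‖f T‖ ^ 2)]
    linarith [hVle T]
  have h6 : ‖f t‖ ^ 2 * (2 * s) ≤ (L + s) * ‖f T‖ ^ 2 + 2 * ((2 + s) * N ^ 2 / c) := by linarith
  have h7 : ‖f t‖ ^ 2 ≤ R * (‖f T‖ + N) ^ 2 := by
    rw [← le_div_iff₀ (by positivity)] at h6
    refine h6.trans ?_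
    have b1 : ‖f T‖ ^ 2 ≤ (‖f T‖ + N) ^ 2 := by gcongr; linarith
    have b2 : N ^ 2 ≤ (‖f T‖ + N) ^ 2 := by gcongr; linarith [norm_nonneg (f T)]
    calc ((L + s) * ‖f T‖ ^ 2 + 2 * ((2 + s) * N ^ 2 / c)) / (2 * s)
        ≤ ((L + s) * (‖f T‖ + N) ^ 2 + 2 * ((2 + s) * (‖f T‖ + N) ^ 2 / c)) / (2 * s) := by gcongr
      _ = _ := by rw [hR]; ring
  refine abs_le_of_sq_le_sq' (h7.trans ?_) (by positivity) |>.2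
  rw [mul_pow]
  gcongr
  nlinarith

/-- The bound of `exists_norm_le_of_near_selfAdjoint` propagated back to the time `0`. -/
lemma exists_norm_le_of_tendsto_atTop {E : Type*} [NormedAddCommGroup E]
    [InnerProductSpace ℝ E] [FiniteDimensional ℝ E] (A : ℝ → E →L[ℝ] E) (S : E →L[ℝ] E)
    (hA_bdd : ∃ K : ℝ, ∀ t : ℝ, ‖A t‖ ≤ K) (hA : Filter.Tendsto A Filter.atTop (nhds S))
    (hS : ∀ x y : E, ⟪S x, y⟫ = ⟪x, S y⟫) (hinj : Function.Injective S) :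
    ∃ C : ℝ, 0 < C ∧ ∀ (f f' : ℝ → E) (N : ℝ), (∀ t, HasDerivAt f (f' t) t) →
      (∃ K, ∀ t, ‖f t‖ ≤ K) → (∀ t, ‖f' t + A t (f t)‖ ≤ N) →
      ∀ t, 0 ≤ t → ‖f t‖ ≤ C * (‖f 0‖ + N) := by
  obtain ⟨K, hK⟩ := hA_bdd
  obtain ⟨κ, hκ, hanti⟩ := LinearMap.exists_antilipschitzWith (S : E →ₗ[ℝ] E)
    (LinearMap.ker_eq_bot.2 hinj)
  have hκ' : (0 : ℝ) < κ := hκ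
  have hSμ : ∀ x, (κ : ℝ)⁻¹ * ‖x‖ ≤ ‖S x‖ := by
    intro x
    have h1 := hanti.le_mul_dist x 0
    simp only [map_zero, dist_zero_right] at h1
    rw [inv_mul_le_iff₀ hκ']
    exact h1
  have hμ : (0 : ℝ) < (κ : ℝ)⁻¹ := inv_pos.2 hκ'
  obtain ⟨T₀, hT₀⟩ := Filter.eventually_atTop.1
    (Metric.tendsto_nhds.1 hA ((κ : ℝ)⁻¹ / 4) (by positivity))
  set T := max T₀ 0
  have hT : 0 ≤ T := le_max_right _ _
  set L := max (max K ‖S‖) 1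
  have hL : 0 < L := lt_max_of_lt_right one_pos
  have hAL : ∀ t, ‖A t‖ ≤ L := fun t => (hK t).trans ((le_max_left _ _).trans (le_max_left _ _))
  obtain ⟨C, hC, hCf⟩ := exists_norm_le_of_near_selfAdjoint A S (T := T) (L := L) hμ hS hSμ
    ((le_max_right _ _).trans (le_max_left _ _)) hAL
    (fun t ht => by
      rw [← dist_eq_norm]
      exact (hT₀ t ((le_max_left _ _).trans ht)).le)
  set G := Real.exp (L * T) + Real.exp (L * T) / L with hG
  have hGpos : 0 < G := by positivity
  refine ⟨G + C * (G + 1), by positivity, ?_⟩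
  intro f f' N hf hfb hN t ht
  have hN0 : 0 ≤ N := (norm_nonneg _).trans (hN 0)
  have hmid : ∀ t ∈ Set.Icc 0 T, ‖f t‖ ≤ G * (‖f 0‖ + N) := by
    intro t ht
    have h1 := norm_le_gronwallBound_of_norm_deriv_right_le (f := f) (f' := f') (δ := ‖f 0‖)
      (K := L) (ε := N) (a := 0) (b := T) (fun t _ => (hf t).continuousAt.continuousWithinAt)
      (fun t _ => (hf t).hasDerivWithinAt) le_rfl (fun t _ => by
        calc ‖f' t‖ = ‖(f' t + A t (f t)) - A t (f t)‖ := by rw [add_sub_cancel_right]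
          _ ≤ ‖f' t + A t (f t)‖ + ‖A t (f t)‖ := norm_sub_le _ _
          _ ≤ N + L * ‖f t‖ := add_le_add (hN t) ((A t).le_of_opNorm_le (hAL t) _)
          _ = _ := add_comm _ _) t ht
    rw [gronwallBound_of_K_ne_0 hL.ne', sub_zero] at h1
    have h2 : Real.exp (L * t) ≤ Real.exp (L * T) := by gcongr; exact ht.2
    calc ‖f t‖ ≤ ‖f 0‖ * Real.exp (L * t) + N / L * (Real.exp (L * t) - 1) := h1
      _ ≤ ‖f 0‖ * Real.exp (L * T) + N / L * Real.exp (L * T) := by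
        gcongr
        linarith
      _ ≤ ‖f 0‖ * Real.exp (L * T) + N / L * Real.exp (L * T) +
          (‖f 0‖ * (Real.exp (L * T) / L) + N * Real.exp (L * T)) :=
        le_add_of_nonneg_right (by positivity)
      _ = _ := by rw [hG]; ring
  rcases le_total t T with htT | htT
  · refine (hmid t ⟨ht, htT⟩).trans ?_
    gcongr
    exact le_add_of_nonneg_right (by positivity)
  · refine (hCf f f' N hf hfb hN t htT).trans ?_
    calc C * (‖f T‖ + N) ≤ C * (G * (‖f 0‖ + N) + (‖f 0‖ + N)) := by
          gcongr
          · exact hmid T ⟨hT, le_rfl⟩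
          · exact le_add_of_nonneg_left (norm_nonneg _)
      _ ≤ G * (‖f 0‖ + N) + C * (G * (‖f 0‖ + N) + (‖f 0‖ + N)) :=
        le_add_of_nonneg_left (by positivity)
      _ = _ := by ring

/-- A bounded function is controlled by its value at `0` and a bound for `f' + A f`. -/
lemma exists_norm_le_of_tendsto_atBot_atTop {E : Type*} [NormedAddCommGroup E]
    [InnerProductSpace ℝ E] [FiniteDimensional ℝ E] (A : ℝ → E →L[ℝ] E)
    (hA_bdd : ∃ K : ℝ, ∀ t : ℝ, ‖A t‖ ≤ K) (Aminus Aplus : E →L[ℝ] E)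
    (hA_minus : Filter.Tendsto A Filter.atBot (nhds Aminus))
    (hA_plus : Filter.Tendsto A Filter.atTop (nhds Aplus))
    (hminus_sa : ∀ x y : E, ⟪Aminus x, y⟫ = ⟪x, Aminus y⟫)
    (hplus_sa : ∀ x y : E, ⟪Aplus x, y⟫ = ⟪x, Aplus y⟫)
    (hminus_inj : Function.Injective Aminus) (hplus_inj : Function.Injective Aplus) :
    ∃ C : ℝ, 0 < C ∧ ∀ (f f' : ℝ → E) (N : ℝ), (∀ t, HasDerivAt f (f' t) t) →
      (∃ K, ∀ t, ‖f t‖ ≤ K) → (∀ t, ‖f' t + A t (f t)‖ ≤ N) →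
      ∀ t, ‖f t‖ ≤ C * (‖f 0‖ + N) := by
  obtain ⟨C₁, hC₁, h₁⟩ := exists_norm_le_of_tendsto_atTop A Aplus hA_bdd hA_plus hplus_sa hplus_inj
  obtain ⟨C₂, hC₂, h₂⟩ := exists_norm_le_of_tendsto_atTop (fun t => -A (-t)) (-Aminus)
    (hA_bdd.imp fun K hK t => by rw [norm_neg]; exact hK _)
    (hA_minus.comp Filter.tendsto_neg_atTop_atBot).neg
    (fun x y => by simp [hminus_sa]) (fun x y hxy => hminus_inj (by simpa using hxy))
  refine ⟨C₁ + C₂, by positivity, fun f f' N hf hfb hN t => ?_⟩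
  have hN0 : 0 ≤ N := (norm_nonneg _).trans (hN 0)
  rcases le_total 0 t with ht | ht
  · refine (h₁ f f' N hf hfb hN t ht).trans ?_
    gcongr
    linarith
  · have h3 := h₂ (fun t => f (-t)) (fun t => -f' (-t)) N
      (fun t => by simpa [Function.comp_def] using (hf (-t)).scomp t (hasDerivAt_neg t))
      (hfb.imp fun K hK t => hK _)
      (fun t => by
        have h4 : -f' (-t) + (-A (-t)) (f (-t)) = -(f' (-t) + A (-t) (f (-t))) := by
          simp [add_comm]
        rw [h4, norm_neg]
        exact hN _) (-t) (by linarith)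
    simp only [neg_neg, neg_zero] at h3
    refine h3.trans ?_
    gcongr
    linarith

lemma integrable_const_mul_exp_neg_mul_abs (C : ℝ) {δ : ℝ} (hδ : 0 < δ) :
    MeasureTheory.Integrable (fun t : ℝ => C * Real.exp (-δ * |t|)) := by
  refine MeasureTheory.Integrable.const_mul ?_ C
  have h1 : MeasureTheory.IntegrableOn (fun t : ℝ => Real.exp (-δ * |t|)) (Set.Iic 0) :=
    (integrableOn_exp_mul_Iic hδ 0).congr_fun (fun t ht => by
      simp [abs_of_nonpos (Set.mem_Iic.1 ht)]) measurableSet_Iic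
  have h2 : MeasureTheory.IntegrableOn (fun t : ℝ => Real.exp (-δ * |t|)) (Set.Ioi 0) :=
    (integrableOn_exp_mul_Ioi (neg_neg_of_pos hδ) 0).congr_fun (fun t ht => by
      simp [abs_of_pos (Set.mem_Ioi.1 ht)]) measurableSet_Ioi
  rw [← MeasureTheory.integrableOn_univ, ← Set.Iic_union_Ioi (a := (0 : ℝ))]
  exact h1.union h2

open Filter MeasureTheory in
/-- The value at `0` of a bounded function is controlled by a bound for `f' + A f` and by the
`L²`-products with a finite orthonormal family spanning the bounded kernel, as soon as bounded
functions are controlled by their value at `0` and a bound for `f' + A f`. -/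
lemma exists_norm_zero_le_of_span {E : Type*} [NormedAddCommGroup E]
    [InnerProductSpace ℝ E] [FiniteDimensional ℝ E] (A : ℝ → E →L[ℝ] E)
    (hA_bdd : ∃ K : ℝ, ∀ t : ℝ, ‖A t‖ ≤ K) {C : ℝ} (hC : 0 < C)
    (hCf : ∀ (f f' : ℝ → E) (N : ℝ), (∀ t, HasDerivAt f (f' t) t) →
      (∃ K, ∀ t, ‖f t‖ ≤ K) → (∀ t, ‖f' t + A t (f t)‖ ≤ N) →
      ∀ t, ‖f t‖ ≤ C * (‖f 0‖ + N))
    {ι : Type*} [Fintype ι] [DecidableEq ι] (h : ι → ℝ → E)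
    (hh_cont : ∀ i, Continuous (h i))
    (hh_bdd : ∀ i, ∃ M, ∀ t, ‖h i t‖ ≤ M)
    (hh_int : ∀ i, Integrable (fun t => ‖h i t‖))
    (hh_on : ∀ i j, (∫ t : ℝ, ⟪h i t, h j t⟫) = if i = j then (1 : ℝ) else 0)
    (hh_span : ∀ g : ℝ → E, (∀ t : ℝ, HasDerivAt g (-(A t (g t))) t) →
      (∃ K : ℝ, ∀ t : ℝ, ‖g t‖ ≤ K) →
      ∃ c : ι → ℝ, ∀ t : ℝ, g t = ∑ i, c i • h i t) :
    ∃ D : ℝ, 0 < D ∧ ∀ (f f' : ℝ → E) (N : ℝ), (∀ t, HasDerivAt f (f' t) t) →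
      (∃ K, ∀ t, ‖f t‖ ≤ K) → (∀ t, ‖f' t + A t (f t)‖ ≤ N) →
      ‖f 0‖ ≤ D * (N + ∑ i, |∫ t : ℝ, ⟪f t, h i t⟫|) := by
  by_contra! hcon
  obtain ⟨K, hK⟩ := hA_bdd
  have hseq : ∀ n : ℕ, ∃ f f' : ℝ → E, (∀ t, HasDerivAt f (f' t) t) ∧
      (∃ K, ∀ t, ‖f t‖ ≤ K) ∧ (∀ t, ‖f' t + A t (f t)‖ ≤ 1 / ((n : ℝ) + 1)) ∧
      (∀ i, |∫ t : ℝ, ⟪f t, h i t⟫| ≤ 1 / ((n : ℝ) + 1)) ∧ ‖f 0‖ = 1 := by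
    intro n
    have hn : (0 : ℝ) < n + 1 := by positivity
    obtain ⟨f, f', N, hf, ⟨M, hM⟩, hN, hlt⟩ := hcon (n + 1) hn
    have hN0 : 0 ≤ N := (norm_nonneg _).trans (hN 0)
    have hsum : 0 ≤ ∑ i, |∫ t : ℝ, ⟪f t, h i t⟫| := Finset.sum_nonneg fun _ _ => abs_nonneg _
    have hpos : 0 < ‖f 0‖ := lt_of_le_of_lt (by positivity) hlt
    set r := ‖f 0‖⁻¹ with hr
    have hrpos : 0 < r := inv_pos.2 hpos
    have hsmall : ∀ y, y ≤ N + ∑ i, |∫ t : ℝ, ⟪f t, h i t⟫| → r * y ≤ 1 / ((n : ℝ) + 1) := by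
      intro y hy
      rw [hr, inv_mul_le_iff₀ hpos, mul_one_div, le_div_iff₀ hn]
      nlinarith
    refine ⟨fun t => r • f t, fun t => r • f' t, fun t => (hf t).const_smul r,
      ⟨r * M, fun t => ?_⟩, fun t => ?_, fun i => ?_, ?_⟩
    · rw [norm_smul, Real.norm_of_nonneg hrpos.le]
      gcongr
      exact hM t
    · rw [map_smul, ← smul_add, norm_smul, Real.norm_of_nonneg hrpos.le]
      exact hsmall _ ((hN t).trans (le_add_of_nonneg_right hsum))
    · simp only [real_inner_smul_left]
      rw [integral_const_mul, abs_mul, abs_of_pos hrpos]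
      exact hsmall _ ((Finset.single_le_sum (f := fun i => |∫ t : ℝ, ⟪f t, h i t⟫|)
        (fun _ _ => abs_nonneg _) (Finset.mem_univ i)).trans (le_add_of_nonneg_left hN0))
    · rw [norm_smul, Real.norm_of_nonneg hrpos.le, hr, inv_mul_cancel₀ hpos.ne']
  choose F F' hF hFb hFN hFi hF0 using hseq
  obtain ⟨x, hx, φ, hφ, hlim⟩ := (isCompact_sphere (0 : E) 1).tendsto_subseq
    (x := fun n => F n 0) (fun n => by simp [hF0])
  have hε : Tendsto (fun n => 1 / ((φ n : ℝ) + 1)) atTop (nhds 0) :=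
    (tendsto_one_div_add_atTop_nhds_zero_nat (𝕜 := ℝ)).comp hφ.tendsto_atTop
  have hdiff : ∀ n k t, ‖F (φ n) t - F (φ k) t‖ ≤ C * (‖F (φ n) 0 - F (φ k) 0‖ +
      (1 / ((φ n : ℝ) + 1) + 1 / ((φ k : ℝ) + 1))) := by
    intro n k
    obtain ⟨M₁, hM₁⟩ := hFb (φ n)
    obtain ⟨M₂, hM₂⟩ := hFb (φ k)
    refine hCf (fun t => F (φ n) t - F (φ k) t) (fun t => F' (φ n) t - F' (φ k) t) _
      (fun t => (hF _ t).sub (hF _ t))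
      ⟨M₁ + M₂, fun t => (norm_sub_le _ _).trans (add_le_add (hM₁ t) (hM₂ t))⟩ fun t => ?_
    have : F' (φ n) t - F' (φ k) t + A t (F (φ n) t - F (φ k) t) =
        (F' (φ n) t + A t (F (φ n) t)) - (F' (φ k) t + A t (F (φ k) t)) := by
      rw [map_sub]; abel
    rw [this]
    exact (norm_sub_le _ _).trans (add_le_add (hFN _ t) (hFN _ t))
  have hcauchy : UniformCauchySeqOn (fun n t => F (φ n) t) atTop Set.univ := by
    rw [Metric.uniformCauchySeqOn_iff]
    intro ε hεpos
    obtain ⟨N₁, hN₁⟩ := Metric.cauchySeq_iff.1 hlim.cauchySeq (ε / (2 * C)) (by positivity)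
    obtain ⟨N₂, hN₂⟩ := eventually_atTop.1
      (hε.eventually_lt_const (by positivity : 0 < ε / (4 * C)))
    refine ⟨max N₁ N₂, fun n hn k hk t _ => ?_⟩
    have h1 := hN₁ n (le_of_max_le_left hn) k (le_of_max_le_left hk)
    have h2 := hN₂ n (le_of_max_le_right hn)
    have h3 := hN₂ k (le_of_max_le_right hk)
    simp only [Function.comp_apply, dist_eq_norm] at h1
    rw [dist_eq_norm]
    calc _ ≤ _ := hdiff n k t
      _ < C * (ε / (2 * C) + (ε / (4 * C) + ε / (4 * C))) := by gcongr
      _ = ε := by field_simp; norm_num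
  have hex : ∀ t, ∃ y, Tendsto (fun n => F (φ n) t) atTop (nhds y) := fun t =>
    cauchySeq_tendsto_of_complete (hcauchy.cauchySeq (Set.mem_univ t))
  choose g hg using hex
  have hunif : TendstoUniformly (fun n t => F (φ n) t) g atTop :=
    tendstoUniformlyOn_univ.1 (hcauchy.tendstoUniformlyOn_of_tendsto fun t _ => hg t)
  have hunif' : TendstoUniformly (fun n t => F' (φ n) t) (fun t => -(A t (g t))) atTop := by
    have hK0 : 0 ≤ K := (norm_nonneg _).trans (hK 0)
    rw [Metric.tendstoUniformly_iff] at hunif ⊢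
    intro ε hεpos
    filter_upwards [hunif (ε / (2 * (K + 1))) (by positivity),
      hε.eventually_lt_const (by positivity : 0 < ε / 2)] with n hn1 hn2 t
    have h1 : -(A t (g t)) - F' (φ n) t =
        -((F' (φ n) t + A t (F (φ n) t)) + A t (g t - F (φ n) t)) := by
      rw [map_sub]; abel
    have h2 : ‖A t (g t - F (φ n) t)‖ ≤ (K + 1) * ‖g t - F (φ n) t‖ :=
      (A t).le_of_opNorm_le ((hK t).trans (by linarith)) _
    have h3 := hn1 t
    rw [dist_eq_norm] at h3 ⊢
    rw [h1, norm_neg]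
    calc _ ≤ _ := norm_add_le _ _
      _ ≤ 1 / ((φ n : ℝ) + 1) + (K + 1) * ‖g t - F (φ n) t‖ := add_le_add (hFN _ t) h2
      _ < ε / 2 + (K + 1) * (ε / (2 * (K + 1))) := by gcongr
      _ = ε := by field_simp; norm_num
  have hgd : ∀ t, HasDerivAt g (-(A t (g t))) t :=
    hasDerivAt_of_tendstoUniformly hunif' (Eventually.of_forall fun n => hF (φ n)) hg
  have hFbd : ∀ n t, ‖F n t‖ ≤ C * (1 + 1) := by
    intro n t
    refine (hCf _ _ _ (hF n) (hFb n) (hFN n) t).trans ?_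
    rw [hF0]
    gcongr
    rw [div_le_one (by positivity)]
    exact le_add_of_nonneg_left (Nat.cast_nonneg n)
  have hgb : ∀ t, ‖g t‖ ≤ C * (1 + 1) := fun t =>
    le_of_tendsto (hg t).norm (Eventually.of_forall fun n => hFbd _ t)
  obtain ⟨c, hc⟩ := hh_span g hgd ⟨_, hgb⟩
  have hint : ∀ u : ℝ → E, Continuous u → (∃ M, ∀ t, ‖u t‖ ≤ M) → ∀ i,
      Integrable (fun t => ⟪u t, h i t⟫) := by
    intro u hu ⟨M, hM⟩ i
    refine ((hh_int i).const_mul M).mono' (hu.inner (hh_cont i)).aestronglyMeasurable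
      (Eventually.of_forall fun t => (norm_inner_le_norm _ _).trans ?_)
    gcongr
    exact hM t
  have hcz : ∀ i, c i = 0 := by
    intro i
    have hlimi : Tendsto (fun n => ∫ t, ⟪F (φ n) t, h i t⟫) atTop (nhds (∫ t, ⟪g t, h i t⟫)) := by
      refine tendsto_integral_of_dominated_convergence (fun t => C * (1 + 1) * ‖h i t‖)
        (fun n => ?_) ((hh_int i).const_mul _)
        (fun n => Eventually.of_forall fun t => (norm_inner_le_norm _ _).trans ?_)
        (Eventually.of_forall fun t => (hg t).inner tendsto_const_nhds)
      · exact ((continuous_iff_continuousAt.2 fun t => (hF (φ n) t).continuousAt).inner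
          (hh_cont i)).aestronglyMeasurable
      · gcongr
        exact hFbd _ t
    have hzero : ∫ t, ⟪g t, h i t⟫ = 0 :=
      tendsto_nhds_unique hlimi (squeeze_zero_norm (fun n => hFi (φ n) i) hε)
    rw [← hzero]
    simp only [hc, sum_inner, real_inner_smul_left]
    rw [integral_finsetSum _ fun j _ => (hint (h j) (hh_cont j) (hh_bdd j) i).const_mul (c j)]
    simp [integral_const_mul, hh_on]
  have hgz : g 0 = 0 := by rw [hc]; simp [hcz]
  have hxg : x = 0 := by rw [← hgz]; exact tendsto_nhds_unique hlim (hg 0)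
  simp [hxg] at hx

/-- Uniform `C⁰` a-priori estimate for the Green's operator of `M f = f' + A f`.
Let `E` be a finite-dimensional real inner product space and `A : ℝ → End(E)` a
continuous, bounded map converging at `±∞` to self-adjoint invertible operators.
Let `h₁, …, hₘ` be exponentially decaying, `L²`-orthonormal `C¹` solutions of
`h' + A h = 0` spanning all bounded solutions.  Then there exists `B > 0` such that
every `C¹` function `f : ℝ → E` with `f` and `f'` bounded satisfies
`sup ‖f‖ + sup ‖f'‖ ≤ B * (sup ‖f' + A f‖ + ∑ᵢ |∫ ⟪f, hᵢ⟫|)`. -/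
theorem stmt_10 {E : Type*} [NormedAddCommGroup E] [InnerProductSpace ℝ E]
    [FiniteDimensional ℝ E]
    (A : ℝ → E →L[ℝ] E) (hA_cont : Continuous A)
    (hA_bdd : ∃ K : ℝ, ∀ t : ℝ, ‖A t‖ ≤ K)
    (Aminus Aplus : E →L[ℝ] E)
    (hA_minus : Filter.Tendsto A Filter.atBot (nhds Aminus))
    (hA_plus : Filter.Tendsto A Filter.atTop (nhds Aplus))
    (hminus_sa : ∀ x y : E, ⟪Aminus x, y⟫ = ⟪x, Aminus y⟫)
    (hplus_sa : ∀ x y : E, ⟪Aplus x, y⟫ = ⟪x, Aplus y⟫)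
    (hminus_inv : Function.Bijective Aminus)
    (hplus_inv : Function.Bijective Aplus)
    (m : ℕ) (h : Fin m → ℝ → E)
    (hh_sol : ∀ i : Fin m, ∀ t : ℝ, HasDerivAt (h i) (-(A t (h i t))) t)
    (hh_decay : ∃ C δ : ℝ, 0 < C ∧ 0 < δ ∧
      ∀ i : Fin m, ∀ t : ℝ, ‖h i t‖ ≤ C * Real.exp (-δ * |t|))
    (hh_on : ∀ i j : Fin m,
      (∫ t : ℝ, ⟪h i t, h j t⟫) = if i = j then (1 : ℝ) else 0)
    (hh_span : ∀ g : ℝ → E, (∀ t : ℝ, HasDerivAt g (-(A t (g t))) t) →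
      (∃ K : ℝ, ∀ t : ℝ, ‖g t‖ ≤ K) →
      ∃ c : Fin m → ℝ, ∀ t : ℝ, g t = ∑ i : Fin m, c i • h i t) :
    ∃ B : ℝ, 0 < B ∧ ∀ f f' : ℝ → E,
      (∀ t : ℝ, HasDerivAt f (f' t) t) →
      (∃ K : ℝ, ∀ t : ℝ, ‖f t‖ ≤ K) →
      (∃ K : ℝ, ∀ t : ℝ, ‖f' t‖ ≤ K) →
      (⨆ t : ℝ, ‖f t‖) + (⨆ t : ℝ, ‖f' t‖) ≤
        B * ((⨆ t : ℝ, ‖f' t + A t (f t)‖) +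
          ∑ i : Fin m, |∫ t : ℝ, ⟪f t, h i t⟫|) := by
  obtain ⟨C, hC, hCf⟩ := exists_norm_le_of_tendsto_atBot_atTop A hA_bdd Aminus Aplus hA_minus
    hA_plus hminus_sa hplus_sa hminus_inv.injective hplus_inv.injective
  obtain ⟨C₀, δ, hC₀, hδ, hdec⟩ := hh_decay
  have hh_cont : ∀ i, Continuous (h i) := fun i =>
    continuous_iff_continuousAt.2 fun t => (hh_sol i t).continuousAt
  obtain ⟨D, hD, hDf⟩ := exists_norm_zero_le_of_span A hA_bdd hC hCf h hh_cont
    (fun i => ⟨C₀, fun t => (hdec i t).trans (mul_le_of_le_one_right hC₀.le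
      (Real.exp_le_one_iff.2 (by nlinarith [abs_nonneg t])))⟩)
    (fun i => (integrable_const_mul_exp_neg_mul_abs C₀ hδ).mono'
      (hh_cont i).norm.aestronglyMeasurable
      (Filter.Eventually.of_forall fun t => by rw [norm_norm]; exact hdec i t))
    hh_on hh_span
  obtain ⟨K, hK⟩ := hA_bdd
  have hK0 : 0 ≤ K := (norm_nonneg _).trans (hK 0)
  refine ⟨C * (D + 1) + (1 + K * (C * (D + 1))), by positivity, ?_⟩
  rintro f f' hf ⟨M, hM⟩ ⟨M', hM'⟩
  have hbdd : BddAbove (Set.range fun t => ‖f' t + A t (f t)‖) := by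
    refine ⟨M' + K * M, ?_⟩
    rintro _ ⟨t, rfl⟩
    exact (norm_add_le _ _).trans (add_le_add (hM' t)
      (((A t).le_of_opNorm_le (hK t) _).trans (by gcongr; exact hM t)))
  have hN : ∀ t, ‖f' t + A t (f t)‖ ≤ ⨆ t, ‖f' t + A t (f t)‖ := le_ciSup hbdd
  set N := ⨆ t, ‖f' t + A t (f t)‖
  have h0 := hDf f f' N hf ⟨M, hM⟩ hN
  have hsum : 0 ≤ ∑ i, |∫ t : ℝ, ⟪f t, h i t⟫| := Finset.sum_nonneg fun _ _ => abs_nonneg _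
  set s := ∑ i, |∫ t : ℝ, ⟪f t, h i t⟫|
  have hsup : ∀ t, ‖f t‖ ≤ C * (D + 1) * (N + s) := by
    intro t
    calc ‖f t‖ ≤ C * (‖f 0‖ + N) := hCf f f' N hf ⟨M, hM⟩ hN t
      _ ≤ C * (D * (N + s) + (N + s)) := by gcongr; linarith
      _ = _ := by ring
  have hsup' : ∀ t, ‖f' t‖ ≤ (1 + K * (C * (D + 1))) * (N + s) := by
    intro t
    calc ‖f' t‖ = ‖(f' t + A t (f t)) - A t (f t)‖ := by rw [add_sub_cancel_right]
      _ ≤ ‖f' t + A t (f t)‖ + ‖A t (f t)‖ := norm_sub_le _ _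
      _ ≤ (N + s) + K * (C * (D + 1) * (N + s)) :=
        add_le_add ((hN t).trans (le_add_of_nonneg_right hsum))
          (((A t).le_of_opNorm_le (hK t) _).trans (by gcongr; exact hsup t))
      _ = _ := by ring
  rw [add_mul]
  exact add_le_add (ciSup_le hsup) (ciSup_le hsup')
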